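/- Let R be a commutative noetherian ring, let a ⊆ b be ideals of R, let X be an arbitrary R-module, and let n be a non-negative integer. If H^i_a(X) is b-torsion for all i with 0 ≤ i ≤ n, then H^i_a(X) ≅ H^i_b(X) for all i with 0 ≤ i ≤ n. -/

import Mathlib

open CategoryTheory

/-- An `R`-module `Y` is `b`-torsion if every element is annihilated by some power of `b`. -/
def IsTorsionWrt {R : Type} [CommRing R] (b : Ideal R) (Y : ModuleCat R) : Prop :=
  ∀ x : Y, ∃ k : ℕ, ∀ r ∈ b ^ k, r • x = 0


namespace LCAux
open CategoryTheory Limits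

section General
universe v u v' u'
variable {C : Type u} [Category.{v} C] [Abelian C]
  {D : Type u'} [Category.{v'} D] [Abelian D]
  (F₁ F₂ F₃ : C ⥤ D) [F₁.Additive] [F₂.Additive] [F₃.Additive]
  (α : F₁ ⟶ F₂) (β : F₂ ⟶ F₃)

/-- short complex of complexes attached to a chain complex -/
noncomputable def sc (h : ∀ Z, α.app Z ≫ β.app Z = 0) (K : ChainComplex C ℕ) :
    ShortComplex (ChainComplex D ℕ) :=
  ShortComplex.mk ((NatTrans.mapHomologicalComplex α (ComplexShape.down ℕ)).app K)
    ((NatTrans.mapHomologicalComplex β (ComplexShape.down ℕ)).app K)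
    (by ext n; exact h _)

noncomputable def scMap (h : ∀ Z, α.app Z ≫ β.app Z = 0) {K L : ChainComplex C ℕ} (φ : K ⟶ L) :
    sc F₁ F₂ F₃ α β h K ⟶ sc F₁ F₂ F₃ α β h L where
  τ₁ := (F₁.mapHomologicalComplex (ComplexShape.down ℕ)).map φ
  τ₂ := (F₂.mapHomologicalComplex (ComplexShape.down ℕ)).map φ
  τ₃ := (F₃.mapHomologicalComplex (ComplexShape.down ℕ)).map φ
  comm₁₂ := by ext n; exact α.naturality _
  comm₂₃ := by ext n; exact β.naturality _

theorem sc_shortExact (h : ∀ Z, α.app Z ≫ β.app Z = 0)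
    (hp : ∀ Z, Projective Z → (ShortComplex.mk (α.app Z) (β.app Z) (h Z)).ShortExact)
    (K : ChainComplex C ℕ) (hK : ∀ n, Projective (K.X n)) :
    (sc F₁ F₂ F₃ α β h K).ShortExact :=
  HomologicalComplex.shortExact_of_degreewise_shortExact _ fun n => hp _ (hK n)


open HomologicalComplex in
noncomputable def dl (h : ∀ Z, α.app Z ≫ β.app Z = 0)
    (hp : ∀ Z, Projective Z → (ShortComplex.mk (α.app Z) (β.app Z) (h Z)).ShortExact)
    (K : ChainComplex C ℕ) (hK : ∀ n, Projective (K.X n)) (n : ℕ) :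
    (homologyFunctor D (ComplexShape.down ℕ) (n+1)).obj
      ((F₃.mapHomologicalComplex (ComplexShape.down ℕ)).obj K) ⟶
    (homologyFunctor D (ComplexShape.down ℕ) n).obj
      ((F₁.mapHomologicalComplex (ComplexShape.down ℕ)).obj K) :=
  (sc_shortExact F₁ F₂ F₃ α β h hp K hK).δ (n+1) n (by simp)

open HomologicalComplex in
theorem dl_naturality (h : ∀ Z, α.app Z ≫ β.app Z = 0)
    (hp : ∀ Z, Projective Z → (ShortComplex.mk (α.app Z) (β.app Z) (h Z)).ShortExact)
    (K L : ChainComplex C ℕ) (hK : ∀ n, Projective (K.X n)) (hL : ∀ n, Projective (L.X n)) (n : ℕ)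
    (φ : K ⟶ L) :
    dl F₁ F₂ F₃ α β h hp K hK n ≫ (homologyFunctor D (ComplexShape.down ℕ) n).map
      ((F₁.mapHomologicalComplex (ComplexShape.down ℕ)).map φ) =
    (homologyFunctor D (ComplexShape.down ℕ) (n+1)).map
      ((F₃.mapHomologicalComplex (ComplexShape.down ℕ)).map φ) ≫ dl F₁ F₂ F₃ α β h hp L hL n :=
  HomologicalComplex.HomologySequence.δ_naturality (scMap F₁ F₂ F₃ α β h φ) _ _ (n+1) n (by simp)

open HomologicalComplex in
theorem dl_exact₁ (h : ∀ Z, α.app Z ≫ β.app Z = 0)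
    (hp : ∀ Z, Projective Z → (ShortComplex.mk (α.app Z) (β.app Z) (h Z)).ShortExact)
    (K : ChainComplex C ℕ) (hK : ∀ n, Projective (K.X n)) (n : ℕ) :
    ∃ w, (ShortComplex.mk (dl F₁ F₂ F₃ α β h hp K hK n)
      ((homologyFunctor D (ComplexShape.down ℕ) n).map
        ((NatTrans.mapHomologicalComplex α (ComplexShape.down ℕ)).app K)) w).Exact :=
  ⟨_, (sc_shortExact F₁ F₂ F₃ α β h hp K hK).homology_exact₁ (n+1) n (by simp)⟩

open HomologicalComplex in
theorem dl_exact₃ (h : ∀ Z, α.app Z ≫ β.app Z = 0)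
    (hp : ∀ Z, Projective Z → (ShortComplex.mk (α.app Z) (β.app Z) (h Z)).ShortExact)
    (K : ChainComplex C ℕ) (hK : ∀ n, Projective (K.X n)) (n : ℕ) :
    ∃ w, (ShortComplex.mk ((homologyFunctor D (ComplexShape.down ℕ) (n+1)).map
        ((NatTrans.mapHomologicalComplex β (ComplexShape.down ℕ)).app K))
        (dl F₁ F₂ F₃ α β h hp K hK n) w).Exact :=
  ⟨_, (sc_shortExact F₁ F₂ F₃ α β h hp K hK).homology_exact₃ (n+1) n (by simp)⟩

theorem exists_delta [EnoughProjectives C] (h : ∀ Z, α.app Z ≫ β.app Z = 0)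
    (hp : ∀ Z, Projective Z → (ShortComplex.mk (α.app Z) (β.app Z) (h Z)).ShortExact) (n : ℕ) :
    ∃ δ : F₃.leftDerived (n+1) ⟶ F₁.leftDerived n,
      ∀ Z, (∃ w, (ShortComplex.mk (δ.app Z) ((NatTrans.leftDerived α n).app Z) w).Exact) ∧
        (∃ w, (ShortComplex.mk ((NatTrans.leftDerived β (n+1)).app Z) (δ.app Z) w).Exact) := by
  let P := fun Z : C => projectiveResolution Z
  let d := fun Z => dl F₁ F₂ F₃ α β h hp (P Z).complex (P Z).projective n
  refine ⟨{ app := fun Z => ((P Z).isoLeftDerivedObj F₃ (n+1)).hom ≫ d Z ≫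
              ((P Z).isoLeftDerivedObj F₁ n).inv
            naturality := ?_ }, ?_⟩
  · intro Z Z' f
    let φ := ProjectiveResolution.lift f (P Z) (P Z')
    have comm : φ.f 0 ≫ (P Z').π.f 0 = (P Z).π.f 0 ≫ f := by
      exact ProjectiveResolution.lift_commutes_zero f (P Z) (P Z')
    have h1 := ProjectiveResolution.isoLeftDerivedObj_hom_naturality f (P Z) (P Z') φ comm F₃ (n+1)
    have h2 := ProjectiveResolution.isoLeftDerivedObj_inv_naturality f (P Z) (P Z') φ comm F₁ n
    have h3 := dl_naturality F₁ F₂ F₃ α β h hp (P Z).complex (P Z').complex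
      (P Z).projective (P Z').projective n φ
    rw [reassoc_of% h1, Category.assoc, Category.assoc, h2]
    dsimp only [Functor.comp_map]
    rw [reassoc_of% h3]
  · intro Z
    constructor
    · obtain ⟨z, e⟩ := dl_exact₁ F₁ F₂ F₃ α β h hp (P Z).complex (P Z).projective n
      have hα := ProjectiveResolution.leftDerived_app_eq α (P Z) n
      have w : (((P Z).isoLeftDerivedObj F₃ (n+1)).hom ≫ d Z ≫
              ((P Z).isoLeftDerivedObj F₁ n).inv) ≫ (NatTrans.leftDerived α n).app Z = 0 := by
        rw [hα]
        simp only [Category.assoc, Iso.inv_hom_id_assoc, d]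
        rw [reassoc_of% z]
        simp
      refine ⟨w, ?_⟩
      refine (ShortComplex.exact_iff_of_iso (ShortComplex.isoMk ((P Z).isoLeftDerivedObj F₃ (n+1))
        ((P Z).isoLeftDerivedObj F₁ n) ((P Z).isoLeftDerivedObj F₂ n) ?_ ?_)).mpr e
      · simp [d]
      · dsimp only [ShortComplex.mk]
        rw [hα, Category.assoc, Category.assoc, Iso.inv_hom_id, Category.comp_id]
    · obtain ⟨z, e⟩ := dl_exact₃ F₁ F₂ F₃ α β h hp (P Z).complex (P Z).projective n
      have hβ := ProjectiveResolution.leftDerived_app_eq β (P Z) (n+1)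
      have w : (NatTrans.leftDerived β (n+1)).app Z ≫ (((P Z).isoLeftDerivedObj F₃ (n+1)).hom ≫ d Z ≫
              ((P Z).isoLeftDerivedObj F₁ n).inv)  = 0 := by
        rw [hβ]
        simp only [Category.assoc, Iso.inv_hom_id_assoc, d]
        rw [reassoc_of% z]
        simp
      refine ⟨w, ?_⟩
      refine (ShortComplex.exact_iff_of_iso (ShortComplex.isoMk ((P Z).isoLeftDerivedObj F₂ (n+1))
        ((P Z).isoLeftDerivedObj F₃ (n+1)) ((P Z).isoLeftDerivedObj F₁ n) ?_ ?_)).mpr e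
      · dsimp only [ShortComplex.mk]
        rw [hβ, Category.assoc, Category.assoc, Iso.inv_hom_id, Category.comp_id]
      · simp [d]
end General


section ExtSec
variable {R : Type} [CommRing R]

theorem isZero_ext_injective (Z E : ModuleCat.{0} R) [Injective E] (n : ℕ) :
    IsZero (((Ext R (ModuleCat.{0} R) (n+1)).obj (Opposite.op Z)).obj E) := by
  let P := projectiveResolution Z
  refine IsZero.of_iso ?_ (P.isoExt (n + 1) E)
  rw [← HomologicalComplex.exactAt_iff_isZero_homology,
    HomologicalComplex.exactAt_iff' _ n (n+1) (n+2) (by simp) (by simp),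
    ShortComplex.moduleCat_exact_iff]
  intro (x : P.complex.X (n+1) ⟶ E) (hx : P.complex.d (n+2) (n+1) ≫ x = 0)
  refine ⟨(P.exact_succ n).descToInjective x hx, ?_⟩
  exact (P.exact_succ n).comp_descToInjective x hx

theorem ext_delta {X E Q : ModuleCat.{0} R} (f : X ⟶ E) (g : E ⟶ Q) (w : f ≫ g = 0)
    (hS : (ShortComplex.mk f g w).ShortExact) [Injective E] (n : ℕ) :
    ∃ δ : ((Ext R (ModuleCat.{0} R) n).flip.obj Q) ⟶ ((Ext R (ModuleCat.{0} R) (n+1)).flip.obj X),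
      ∀ Z, Function.Surjective (δ.app Z) ∧
        (∀ x, δ.app Z x = 0 ↔ ∃ y, ((Ext R (ModuleCat.{0} R) n).obj Z).map g y = x) := by
  let C := ModuleCat.{0} R
  let F := fun Y : C => ((linearYoneda R C).obj Y).rightOp
  let α : F Q ⟶ F E := NatTrans.rightOp ((linearYoneda R C).map g)
  let β : F E ⟶ F X := NatTrans.rightOp ((linearYoneda R C).map f)
  have h : ∀ Z, α.app Z ≫ β.app Z = 0 := by
    intro Z
    apply Quiver.Hom.unop_inj
    ext (x : Z ⟶ X)
    change (x ≫ f) ≫ g = 0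
    rw [Category.assoc, w, comp_zero]
  have hp : ∀ Z, Projective Z → (ShortComplex.mk (α.app Z) (β.app Z) (h Z)).ShortExact := by
    intro Z hZ
    have w' : ((linearYoneda R C).map f).app (Opposite.op Z) ≫ ((linearYoneda R C).map g).app (Opposite.op Z) = 0 := by
      ext (x : Z ⟶ X)
      change (x ≫ f) ≫ g = 0
      rw [Category.assoc, w, comp_zero]
    have : (ShortComplex.mk _ _ w').ShortExact := by
      have := hS.mono_f
      have := hS.epi_g
      refine ModuleCat.shortComplex_shortExact _ ?_ ?_ ?_
      · rw [← ShortComplex.ShortExact.moduleCat_exact_iff_function_exact, ShortComplex.moduleCat_exact_iff]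
        intro (x : Z ⟶ E) (hx : x ≫ g = 0)
        exact ⟨hS.exact.lift x hx, hS.exact.lift_f x hx⟩
      · intro (x : Z ⟶ X) (y : Z ⟶ X) (hxy : x ≫ f = y ≫ f)
        exact (cancel_mono f).mp hxy
      · intro (x : Z ⟶ Q)
        exact ⟨Projective.factorThru x g, Projective.factorThru_comp x g⟩
    exact this.op
  obtain ⟨δ, hδ⟩ := exists_delta (F Q) (F E) (F X) α β h hp n
  refine ⟨NatTrans.leftOp δ, ?_⟩
  intro Z
  obtain ⟨⟨w1, e1⟩, ⟨w3, e3⟩⟩ := hδ Z.unop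
  constructor
  · have e := e3.unop
    rw [ShortComplex.moduleCat_exact_iff] at e
    intro x
    refine e x ?_
    exact @Subsingleton.elim _ (ModuleCat.subsingleton_of_isZero (isZero_ext_injective Z.unop E n)) _ _
  · have e := e1.unop
    rw [ShortComplex.moduleCat_exact_iff] at e
    intro x
    constructor
    · intro hx
      exact e x hx
    · rintro ⟨y, rfl⟩
      have := congr_arg Quiver.Hom.unop w1
      exact ConcreteCategory.congr_hom this y
end ExtSec

section ExtZero

theorem fromLeftDerivedZero_nat {C : Type*} [Category C] [Abelian C] [EnoughProjectives C]
  {D : Type*} [Category D] [Abelian D]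
  (F G : C ⥤ D) [F.Additive] [G.Additive] (α : F ⟶ G) (Z : C) :
    (NatTrans.leftDerived α 0).app Z ≫ G.fromLeftDerivedZero.app Z =
      F.fromLeftDerivedZero.app Z ≫ α.app Z := by
  let P := projectiveResolution Z
  rw [ProjectiveResolution.leftDerived_app_eq α P, P.fromLeftDerivedZero_eq F,
    P.fromLeftDerivedZero_eq G]
  simp only [Category.assoc, Iso.inv_hom_id_assoc]
  congr 1
  have h0 : HomologicalComplex.opcyclesMap
      ((NatTrans.mapHomologicalComplex α (ComplexShape.down ℕ)).app P.complex) 0 ≫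
      P.fromLeftDerivedZero' G = P.fromLeftDerivedZero' F ≫ α.app Z := ?_
  · have h1 := ChainComplex.isoHomologyι₀_inv_naturality
      ((NatTrans.mapHomologicalComplex α (ComplexShape.down ℕ)).app P.complex)
    have key : HomologicalComplex.homologyMap
        ((NatTrans.mapHomologicalComplex α (ComplexShape.down ℕ)).app P.complex) 0 ≫
        (ChainComplex.isoHomologyι₀ ((G.mapHomologicalComplex (ComplexShape.down ℕ)).obj
          P.complex)).hom ≫ P.fromLeftDerivedZero' G =
        (ChainComplex.isoHomologyι₀ ((F.mapHomologicalComplex (ComplexShape.down ℕ)).obj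
          P.complex)).hom ≫ P.fromLeftDerivedZero' F ≫ α.app Z := by
      rw [← h0, ← Iso.inv_comp_eq, reassoc_of% h1, Iso.inv_hom_id_assoc]
    exact key.trans (Category.assoc _ _ _).symm
  rw [← cancel_epi (HomologicalComplex.pOpcycles _ _)]
  rw [HomologicalComplex.p_opcyclesMap_assoc, P.pOpcycles_comp_fromLeftDerivedZero',
     ← Category.assoc, P.pOpcycles_comp_fromLeftDerivedZero']
  exact (α.naturality _).symm

variable {R : Type} [CommRing R]

instance presColim (Y : ModuleCat.{0} R) :
    PreservesFiniteColimits ((linearYoneda R (ModuleCat.{0} R)).obj Y).rightOp := by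
  have : PreservesLimits (((linearYoneda R (ModuleCat.{0} R)).obj Y) ⋙ forget (ModuleCat.{0} R)) :=
    inferInstanceAs (PreservesLimits (yoneda.obj Y))
  have : PreservesLimits ((linearYoneda R (ModuleCat.{0} R)).obj Y) :=
    preservesLimits_of_reflects_of_preserves _ (forget (ModuleCat.{0} R))
  have : PreservesFiniteLimits ((linearYoneda R (ModuleCat.{0} R)).obj Y) := inferInstance
  exact preservesFiniteColimits_rightOp _

theorem ext_zero :
    ∃ θ : ∀ Y : ModuleCat.{0} R, ((Ext R (ModuleCat.{0} R) 0).flip.obj Y) ⟶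
        (linearYoneda R (ModuleCat.{0} R)).obj Y,
      (∀ Y Z, Function.Bijective ((θ Y).app Z)) ∧
      ∀ (Y Y' : ModuleCat.{0} R) (g : Y ⟶ Y') (Z) (x : ((Ext R (ModuleCat.{0} R) 0).obj Z).obj Y),
        (show Z.unop ⟶ Y' from (θ Y').app Z (((Ext R (ModuleCat.{0} R) 0).obj Z).map g x)) =
         (show Z.unop ⟶ Y from (θ Y).app Z x) ≫ g := by
  let C := ModuleCat.{0} R
  let F := fun Y : C => ((linearYoneda R C).obj Y).rightOp
  -- inverse direction in the opposite category
  refine ⟨fun Y => NatTrans.leftOp (Functor.leftDerivedZeroIsoSelf (F Y)).inv, ?_, ?_⟩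
  · intro Y Z
    have : IsIso ((NatTrans.leftOp (Functor.leftDerivedZeroIsoSelf (F Y)).inv).app Z) := by
      dsimp; infer_instance
    exact @ConcreteCategory.bijective_of_isIso _ _ _ _ _ _ _ _ _ this
  · intro Y Y' g Z x
    have h := fromLeftDerivedZero_nat (F Y') (F Y) (NatTrans.rightOp ((linearYoneda R C).map g)) Z.unop
    have h2 : (F Y').leftDerivedZeroIsoSelf.inv.app Z.unop ≫ (NatTrans.leftDerived (NatTrans.rightOp ((linearYoneda R C).map g)) 0).app Z.unop = (NatTrans.rightOp ((linearYoneda R C).map g)).app Z.unop ≫ (F Y).leftDerivedZeroIsoSelf.inv.app Z.unop := by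
      rw [← cancel_mono ((F Y).fromLeftDerivedZero.app Z.unop), Category.assoc, h, Category.assoc,
        Functor.leftDerivedZeroIsoSelf_inv_hom_id_app, Category.comp_id,
        ← Category.assoc, Functor.leftDerivedZeroIsoSelf_inv_hom_id_app, Category.id_comp]
    exact ConcreteCategory.congr_hom (congr_arg Quiver.Hom.unop h2) x
end ExtZero

section LC
variable {R : Type} [CommRing R]
open localCohomology Opposite

noncomputable abbrev dg (J : Ideal R) (i : ℕ) :
    ℕᵒᵖᵒᵖ ⥤ ModuleCat.{0} R ⥤ ModuleCat.{0} R := diagram (idealPowersDiagram J) i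

noncomputable def lcι (J : Ideal R) (i : ℕ) (X : ModuleCat.{0} R) (t : ℕᵒᵖᵒᵖ) :
    ((dg J i).obj t).obj X ⟶ (localCohomology J i).obj X :=
  (colimit.ι (dg J i) t).app X

noncomputable def lcCocone (J : Ideal R) (i : ℕ) (X : ModuleCat.{0} R) :
    Cocone ((dg J i) ⋙ (evaluation _ _).obj X) :=
  ((evaluation _ _).obj X).mapCocone (colimit.cocone (dg J i))

noncomputable def lcIsColimit (J : Ideal R) (i : ℕ) (X : ModuleCat.{0} R) :
    IsColimit (lcCocone J i X) :=
  isColimitOfPreserves ((evaluation _ _).obj X) (colimit.isColimit (dg J i))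

theorem lc_rep (J : Ideal R) (i : ℕ) (X : ModuleCat.{0} R) (x : (localCohomology J i).obj X) :
    ∃ t y, lcι J i X t y = x :=
  Concrete.isColimit_exists_rep _ (lcIsColimit J i X) x

theorem lc_zero (J : Ideal R) (i : ℕ) (X : ModuleCat.{0} R) (t : ℕᵒᵖᵒᵖ)
    (y : ((dg J i).obj t).obj X) (h : lcι J i X t y = 0) :
    ∃ (t' : ℕᵒᵖᵒᵖ) (f : t ⟶ t'), ((dg J i).map f).app X y = 0 := by
  have h' : (lcCocone J i X).ι.app t y =
      (lcCocone J i X).ι.app t (0 : ((dg J i).obj t).obj X) := by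
    rw [map_zero]; exact h
  obtain ⟨t', f, g, e⟩ := Concrete.isColimit_exists_of_rep_eq _ (lcIsColimit J i X) _ _ h'
  refine ⟨t', f, ?_⟩
  refine Eq.trans e ?_
  exact map_zero _

theorem lc_w (J : Ideal R) (i : ℕ) (X : ModuleCat.{0} R) {t t' : ℕᵒᵖᵒᵖ} (f : t ⟶ t')
    (y : ((dg J i).obj t).obj X) : lcι J i X t' (((dg J i).map f).app X y) = lcι J i X t y :=
  ConcreteCategory.congr_hom ((lcCocone J i X).w f) y

theorem lc_map (J : Ideal R) (i : ℕ) {X Y : ModuleCat.{0} R} (g : X ⟶ Y) (t : ℕᵒᵖᵒᵖ)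
    (y : ((dg J i).obj t).obj X) :
    (localCohomology J i).map g (lcι J i X t y) = lcι J i Y t (((dg J i).obj t).map g y) :=
  (ConcreteCategory.congr_hom ((colimit.ι (dg J i) t).naturality g) y).symm

theorem lc_delta (J : Ideal R) {X E Q : ModuleCat.{0} R} (f : X ⟶ E) (g : E ⟶ Q) (w : f ≫ g = 0)
    (hS : (ShortComplex.mk f g w).ShortExact) [Injective E] (n : ℕ) :
    ∃ δ : (localCohomology J n).obj Q ⟶ (localCohomology J (n+1)).obj X,
      Function.Surjective δ ∧
        (∀ x, δ x = 0 ↔ ∃ y, (localCohomology J n).map g y = x) := by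
  obtain ⟨δ, hnat', hsurj, hker⟩ :
      ∃ δt : ∀ t, ((dg J n).obj t).obj Q ⟶ ((dg J (n+1)).obj t).obj X,
        (∀ {t t'} (m : t ⟶ t'), ((dg J n).map m).app Q ≫ δt t' =
          δt t ≫ ((dg J (n+1)).map m).app X) ∧
        (∀ t, Function.Surjective (δt t)) ∧
        (∀ t x, δt t x = 0 ↔ ∃ y, ((dg J n).obj t).map g y = x) := by
    obtain ⟨δ, hδ⟩ := ext_delta f g w hS n
    exact ⟨fun t => δ.app ((ringModIdeals (idealPowersDiagram J)).op.obj t),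
      fun m => δ.naturality ((ringModIdeals (idealPowersDiagram J)).op.map m),
      fun t => (hδ _).1, fun t => (hδ _).2⟩
  have hw : ∀ {t t'} (m : t ⟶ t'), ((dg J (n+1)).map m).app X ≫ lcι J (n+1) X t' =
      lcι J (n+1) X t := fun m => (lcCocone J (n+1) X).w m
  let c : Cocone ((dg J n) ⋙ (evaluation _ _).obj Q) :=
    { pt := (localCohomology J (n+1)).obj X
      ι :=
      { app := fun t => δ t ≫ lcι J (n+1) X t
        naturality := by
          intro t t' m
          change ((dg J n).map m).app Q ≫ δ t' ≫ lcι J (n+1) X t' =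
            (δ t ≫ lcι J (n+1) X t) ≫ 𝟙 _
          rw [Category.comp_id, ← hw m, ← Category.assoc, hnat', Category.assoc] } }
  let d : (localCohomology J n).obj Q ⟶ (localCohomology J (n+1)).obj X :=
    (lcIsColimit J n Q).desc c
  have hd : ∀ t y, d (lcι J n Q t y) = lcι J (n+1) X t (δ t y) := fun t y =>
    ConcreteCategory.congr_hom ((lcIsColimit J n Q).fac c t) y
  have hnat : ∀ {t t'} (m : t ⟶ t') y, δ t' (((dg J n).map m).app Q y) =
      ((dg J (n+1)).map m).app X (δ t y) := fun m y =>
    ConcreteCategory.congr_hom (hnat' m) y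
  refine ⟨d, ?_, ?_⟩
  · intro x
    obtain ⟨t, y, rfl⟩ := lc_rep _ _ _ x
    obtain ⟨z, hz⟩ := hsurj t y
    exact ⟨lcι J n Q t z, by rw [hd, hz]⟩
  · intro x
    constructor
    · intro hx
      obtain ⟨t, y, rfl⟩ := lc_rep _ _ _ x
      rw [hd] at hx
      obtain ⟨t', m, hm⟩ := lc_zero _ _ _ _ _ hx
      rw [← hnat] at hm
      obtain ⟨z, hz⟩ := (hker t' _).1 hm
      refine ⟨lcι J n E t' z, ?_⟩
      rw [lc_map, ← lc_w J n Q m]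
      exact congr_arg _ hz
    · rintro ⟨y, rfl⟩
      obtain ⟨t, y, rfl⟩ := lc_rep _ _ _ y
      rw [lc_map, hd, (hker t _).2 ⟨y, rfl⟩, map_zero]

theorem lc_injective_zero (J : Ideal R) (E : ModuleCat.{0} R) [Injective E] (n : ℕ)
    (x : (localCohomology J (n+1)).obj E) : x = 0 := by
  obtain ⟨t, y, rfl⟩ := lc_rep _ _ _ x
  have : y = 0 := @Subsingleton.elim _ (ModuleCat.subsingleton_of_isZero
    (isZero_ext_injective ((ringModIdeals (idealPowersDiagram J)).obj t.unop) E n)) _ _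
  rw [this, map_zero]

/-- The `J`-torsion submodule. -/
def Gam (J : Ideal R) (M : Type) [AddCommGroup M] [Module R M] : Submodule R M where
  carrier := {x | ∃ k : ℕ, ∀ r ∈ J ^ k, r • x = 0}
  zero_mem' := ⟨0, by simp⟩
  add_mem' := by
    rintro x y ⟨k, hk⟩ ⟨l, hl⟩
    refine ⟨k + l, fun r hr => ?_⟩
    rw [smul_add, hk r (Ideal.pow_le_pow_right (Nat.le_add_right _ _) hr),
      hl r (Ideal.pow_le_pow_right (Nat.le_add_left _ _) hr), add_zero]
  smul_mem' := by
    rintro c x ⟨k, hk⟩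
    exact ⟨k, fun r hr => by rw [smul_comm, hk r hr, smul_zero]⟩

theorem mem_Gam {J : Ideal R} {M : Type} [AddCommGroup M] [Module R M] {x : M} :
    x ∈ Gam J M ↔ ∃ k : ℕ, ∀ r ∈ J ^ k, r • x = 0 := Iff.rfl

theorem lc_zeroth (J : Ideal R) :
    ∃ ev : ∀ X : ModuleCat.{0} R, (localCohomology J 0).obj X →ₗ[R] X,
      (∀ X, Function.Injective (ev X)) ∧ (∀ X, LinearMap.range (ev X) = Gam J X) ∧
      ∀ (X Y : ModuleCat.{0} R) (g : X ⟶ Y) x,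
        ev Y ((localCohomology J 0).map g x) = g (ev X x) := by
  obtain ⟨θ, hθ, hn⟩ := ext_zero (R := R)
  let q : ℕᵒᵖᵒᵖ → (ModuleCat.{0} R)ᵒᵖ := fun t => (ringModIdeals (idealPowersDiagram J)).op.obj t
  let e1 : ∀ (X : ModuleCat.{0} R) (t : ℕᵒᵖᵒᵖ), ((q t).unop ⟶ X) →ₗ[R] X := fun X t =>
    { toFun := fun φ => φ.hom (Ideal.Quotient.mk _ 1)
      map_add' := fun _ _ => rfl
      map_smul' := fun _ _ => rfl }
  have he1 : ∀ X t (φ : (q t).unop ⟶ X), e1 X t φ = 0 → φ = 0 := by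
    intro X t φ h
    apply ModuleCat.hom_ext
    apply LinearMap.ext
    intro z
    obtain ⟨r, rfl⟩ := Ideal.Quotient.mk_surjective z
    have : φ.hom (r • (Ideal.Quotient.mk _ 1)) = r • e1 X t φ := φ.hom.map_smul _ _
    rw [h, smul_zero] at this
    rw [← mul_one r]
    exact this
  let c : ∀ X : ModuleCat.{0} R, Cocone ((dg J 0) ⋙ (evaluation _ _).obj X) := fun X =>
    { pt := X
      ι :=
      { app := fun t => (θ X).app (q t) ≫ ModuleCat.ofHom (e1 X t)
        naturality := by
          intro t t' m
          have h1 := (θ X).naturality ((ringModIdeals (idealPowersDiagram J)).op.map m)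
          ext y
          have h2 := congr_arg (e1 X t') (ConcreteCategory.congr_hom h1 y)
          exact h2 } }
  let d : ∀ X : ModuleCat.{0} R, (localCohomology J 0).obj X ⟶ X := fun X =>
    (lcIsColimit J 0 X).desc (c X)
  have hd : ∀ X t y, d X (lcι J 0 X t y) = e1 X t ((θ X).app (q t) y) := fun X t y =>
    ConcreteCategory.congr_hom ((lcIsColimit J 0 X).fac (c X) t) y
  refine ⟨fun X => (d X).hom, ?_, ?_, ?_⟩
  · intro X
    rw [injective_iff_map_eq_zero]
    intro x hx
    obtain ⟨t, y, rfl⟩ := lc_rep _ _ _ x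
    have h1 := he1 _ _ _ ((hd X t y).symm.trans hx)
    have h2 : y = 0 := (hθ X (q t)).1 (h1.trans (map_zero ((θ X).app (q t)).hom).symm)
    rw [h2, map_zero]
  · intro X
    ext x
    rw [mem_Gam]
    constructor
    · rintro ⟨z, rfl⟩
      obtain ⟨t, y, rfl⟩ := lc_rep _ _ _ z
      refine ⟨t.unop.unop, fun r hr => ?_⟩
      have h1 := hd X t y
      set φ : (q t).unop ⟶ X := (θ X).app (q t) y with hφ
      have : φ.hom (r • (Ideal.Quotient.mk _ 1)) = r • e1 X t φ := φ.hom.map_smul _ _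
      refine (congr_arg (r • ·) h1).trans (this.symm.trans ?_)
      have h0 : (r • (Ideal.Quotient.mk (J ^ t.unop.unop) 1)) = 0 := by
        have : r • (Ideal.Quotient.mk (J ^ t.unop.unop) 1) = Ideal.Quotient.mk (J ^ t.unop.unop) (r * 1) := rfl
        rw [this, mul_one]
        exact Ideal.Quotient.eq_zero_iff_mem.2 hr
      exact (congr_arg φ.hom h0).trans (map_zero _)
    · rintro ⟨k, hk⟩
      let t : ℕᵒᵖᵒᵖ := op (op k)
      let φ : (q t).unop ⟶ X := ModuleCat.ofHom (Submodule.liftQ (J ^ k)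
        (LinearMap.toSpanSingleton R X x) (fun r hr => LinearMap.mem_ker.2 (hk r hr)))
      obtain ⟨y, hy⟩ := (hθ X (q t)).2 φ
      refine ⟨lcι J 0 X t y, ?_⟩
      refine (hd X t y).trans ?_
      rw [hy]
      change LinearMap.toSpanSingleton R X x 1 = x
      simp
  · intro X Y g x
    obtain ⟨t, y, rfl⟩ := lc_rep _ _ _ x
    rw [lc_map]
    refine (hd Y t _).trans ?_
    refine Eq.trans ?_ (congr_arg g (hd X t y)).symm
    exact congr_arg (e1 Y t) (hn X Y g (q t) y)

end LC

section Alg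
variable {R : Type} [CommRing R]

theorem Gam_uniform (J : Ideal R) {M : Type} [AddCommGroup M] [Module R M] (P : Submodule R M)
    (hP : P.FG) (h : P ≤ Gam J M) : ∃ k : ℕ, ∀ r ∈ J ^ k, ∀ x ∈ P, r • x = 0 := by
  induction P, hP using Submodule.fg_induction with
  | singleton x =>
    obtain ⟨k, hk⟩ := h (Submodule.mem_span_singleton_self x)
    refine ⟨k, fun r hr y hy => ?_⟩
    obtain ⟨c, rfl⟩ := Submodule.mem_span_singleton.1 hy
    rw [smul_comm, hk r hr, smul_zero]
  | sup N₁ N₂ _ _ h₁ h₂ =>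
    obtain ⟨k, hk⟩ := h₁ (le_sup_left.trans h)
    obtain ⟨l, hl⟩ := h₂ (le_sup_right.trans h)
    refine ⟨k + l, fun r hr y hy => ?_⟩
    obtain ⟨y₁, hy₁, y₂, hy₂, rfl⟩ := Submodule.mem_sup.1 hy
    rw [smul_add, hk r (Ideal.pow_le_pow_right (Nat.le_add_right _ _) hr) _ hy₁,
      hl r (Ideal.pow_le_pow_right (Nat.le_add_left _ _) hr) _ hy₂, add_zero]

/-- An element some power multiple of which is torsion is torsion. -/
theorem Gam_of_smul [IsNoetherianRing R] (J : Ideal R) {M : Type} [AddCommGroup M] [Module R M]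
    (x : M) (k : ℕ) (h : ∀ r ∈ J ^ k, r • x ∈ Gam J M) : x ∈ Gam J M := by
  let P : Submodule R M := Submodule.map (LinearMap.toSpanSingleton R M x) (J ^ k : Ideal R)
  obtain ⟨l, hl⟩ := Gam_uniform J P ((IsNoetherian.noetherian (J ^ k : Ideal R)).map _) (by
    rintro _ ⟨r, hr, rfl⟩
    exact h r hr)
  refine ⟨l + k, fun r hr => ?_⟩
  rw [pow_add] at hr
  induction hr using Submodule.mul_induction_on' with
  | mem_mul_mem s hs r hr =>
    rw [mul_smul]
    exact hl s hs _ ⟨r, hr, rfl⟩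
  | add u _ v _ hu hv => rw [add_smul, hu, hv, add_zero]

theorem Gam_mono {a b : Ideal R} (hab : a ≤ b) (M : Type) [AddCommGroup M] [Module R M] :
    Gam b M ≤ Gam a M := by
  rintro x ⟨k, hk⟩
  exact ⟨k, fun r hr => hk r (Ideal.pow_right_mono hab k hr)⟩

theorem Gam_map (J : Ideal R) {M N : Type} [AddCommGroup M] [Module R M] [AddCommGroup N]
    [Module R N] (f : M →ₗ[R] N) {x : M} (hx : x ∈ Gam J M) : f x ∈ Gam J N := by
  obtain ⟨k, hk⟩ := hx
  exact ⟨k, fun r hr => by rw [← map_smul, hk r hr, map_zero]⟩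

theorem Gam_of_inj (J : Ideal R) {M N : Type} [AddCommGroup M] [Module R M] [AddCommGroup N]
    [Module R N] (f : M →ₗ[R] N) (hf : Function.Injective f) {x : M} (hx : f x ∈ Gam J N) :
    x ∈ Gam J M := by
  obtain ⟨k, hk⟩ := hx
  exact ⟨k, fun r hr => hf (by rw [map_smul, hk r hr, map_zero])⟩

theorem Gam_injective [IsNoetherianRing R] (J : Ideal R) (M : Type) [AddCommGroup M] [Module R M]
    [Module.Injective R M] : Module.Injective R (Gam J M) := by
  apply Module.Baer.injective
  intro I g
  let g0 : I →ₗ[R] M := (Gam J M).subtype ∘ₗ g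
  obtain ⟨k, hk⟩ := Gam_uniform J (LinearMap.range g0)
    (by rw [LinearMap.range_eq_map]; exact (IsNoetherian.noetherian (⊤ : Submodule R I)).map _)
    (by rintro _ ⟨y, rfl⟩; exact (g y).2)
  obtain ⟨c, hc⟩ := Ideal.exists_pow_inf_eq_pow_smul (M := R) J I
  have hc' := hc (c + k) (Nat.le_add_right _ _)
  rw [Nat.add_sub_cancel_left] at hc'
  let φ : I →ₗ[R] R ⧸ (J ^ (c + k)) := (Submodule.mkQ _) ∘ₗ (Submodule.subtype I)
  have hker : LinearMap.ker φ ≤ LinearMap.ker g0 := by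
    intro x hx
    have h1 : (x : R) ∈ J ^ (c + k) := (Submodule.Quotient.mk_eq_zero _).1 hx
    have h2 : (x : R) ∈ J ^ k • (J ^ c • ⊤ ⊓ I) := by
      rw [← hc']
      refine ⟨?_, x.2⟩
      simpa using h1
    have key : ∀ z : R, z ∈ J ^ k • (J ^ c • ⊤ ⊓ I) → ∃ hz : z ∈ I, g0 ⟨z, hz⟩ = 0 := by
      intro z hz
      refine Submodule.smul_induction_on (p := fun z => ∃ hz : z ∈ I, g0 ⟨z, hz⟩ = 0) hz ?_ ?_
      · intro r hr n hn
        refine ⟨I.mul_mem_left _ hn.2, ?_⟩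
        have : (⟨r • n, I.mul_mem_left _ hn.2⟩ : I) = r • ⟨n, hn.2⟩ := rfl
        rw [this, map_smul]
        exact hk r hr _ ⟨_, rfl⟩
      · intro u v hu hv
        obtain ⟨hu, hu'⟩ := hu
        obtain ⟨hv, hv'⟩ := hv
        refine ⟨I.add_mem hu hv, ?_⟩
        have : (⟨u + v, I.add_mem hu hv⟩ : I) = ⟨u, hu⟩ + ⟨v, hv⟩ := rfl
        rw [this, map_add, hu', hv', add_zero]
    obtain ⟨_, h3⟩ := key _ h2
    exact h3
  obtain ⟨e, he⟩ := Module.Injective.extension_property R M _ _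
    ((LinearMap.ker φ).liftQ φ le_rfl)
    (LinearMap.ker_eq_bot.1 (Submodule.ker_liftQ_eq_bot' _ _ rfl))
    ((LinearMap.ker φ).liftQ g0 hker)
  refine ⟨(e ∘ₗ Submodule.mkQ _).codRestrict (Gam J M) ?_, ?_⟩
  · intro r
    refine ⟨c + k, fun s hs => ?_⟩
    rw [← map_smul, LinearMap.comp_apply]
    have : Submodule.mkQ (J ^ (c + k)) (s • r) = 0 :=
      (Submodule.Quotient.mk_eq_zero _).2 (Ideal.mul_mem_right _ _ hs)
    rw [this, map_zero]
  · intro x hx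
    apply Subtype.ext
    have := LinearMap.congr_fun he (Submodule.Quotient.mk ⟨x, hx⟩)
    exact this

theorem exists_good_embedding [IsNoetherianRing R] {a b : Ideal R} (hab : a ≤ b)
    (X : ModuleCat.{0} R) (h : Gam a X ≤ Gam b X) :
    ∃ (E : ModuleCat.{0} R) (f : X ⟶ E), Injective E ∧ Function.Injective f ∧
      Gam a E ≤ Gam b E := by
  have emb : ∀ X : ModuleCat.{0} R, ∃ (E : ModuleCat.{0} R) (f : X →ₗ[R] E),
      Module.Injective R E ∧ Function.Injective f := by
    intro X
    refine ⟨Injective.under X, (Injective.ι X).hom, ?_, ?_⟩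
    · exact @Module.injective_module_of_injective_object R _ _ _ _
        (Injective.injective_under X)
    · exact (ModuleCat.mono_iff_injective (Injective.ι X)).1 inferInstance
  obtain ⟨E0, ι, hE0, hι⟩ := emb X
  have hE1 := Gam_injective b E0
  let T := Gam b X
  obtain ⟨u, hu⟩ := Module.Injective.extension_property R (Gam b E0) T X T.subtype
    T.injective_subtype ((ι ∘ₗ T.subtype).codRestrict (Gam b E0) (fun x => Gam_map b ι x.2))
  obtain ⟨E3, κ, hE3, hκ⟩ := emb (ModuleCat.of R (X ⧸ T))
  have hG := Gam_injective a E3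
  obtain ⟨r, hr⟩ := Module.Injective.extension_property R (Gam a E3) (Gam a E3) E3
    (Gam a E3).subtype (Gam a E3).injective_subtype LinearMap.id
  have hr' : ∀ x : Gam a E3, r x = x := fun x => LinearMap.congr_fun hr x
  let p : E3 →ₗ[R] LinearMap.ker r :=
    (LinearMap.id - (Gam a E3).subtype ∘ₗ r).codRestrict (LinearMap.ker r) (fun x => by
      rw [LinearMap.mem_ker]
      simp [hr'])
  have hp : ∀ x : LinearMap.ker r, p x = x := by
    intro x
    apply Subtype.ext
    have : r x = 0 := x.2
    simp [p, this]
  let κ' : (X ⧸ T) →ₗ[R] E3 := κ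
  let v : X →ₗ[R] LinearMap.ker r := p ∘ₗ κ' ∘ₗ T.mkQ
  let f : X →ₗ[R] (Gam b E0 × LinearMap.ker r) := u.prod v
  have hE : Module.Injective R (Gam b E0 × LinearMap.ker r) := by
    constructor
    intro A B _ _ _ _ i hi g
    obtain ⟨h1, hh1⟩ := hE1.out i hi (LinearMap.fst R _ _ ∘ₗ g)
    obtain ⟨h2, hh2⟩ := hE3.out i hi ((LinearMap.ker r).subtype ∘ₗ LinearMap.snd R _ _ ∘ₗ g)
    refine ⟨h1.prod (p ∘ₗ h2), fun x => ?_⟩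
    apply Prod.ext
    · exact hh1 x
    · exact (congr_arg p (hh2 x)).trans (hp _)
  refine ⟨ModuleCat.of R (Gam b E0 × LinearMap.ker r), ModuleCat.ofHom f,
    Module.injective_object_of_injective_module R _, ?_, ?_⟩
  · change Function.Injective f
    rw [injective_iff_map_eq_zero]
    intro x hx
    have h1 : u x = 0 := congr_arg Prod.fst hx
    have h2 : p (κ' (T.mkQ x)) = 0 := congr_arg Prod.snd hx
    have h3 : κ' (T.mkQ x) ∈ Gam a E3 := by
      have : κ' (T.mkQ x) - (r (κ' (T.mkQ x)) : E3) = 0 := congr_arg Subtype.val h2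
      rw [sub_eq_zero] at this
      rw [this]
      exact (r _).2
    obtain ⟨k, hk⟩ := Gam_of_inj a κ' hκ h3
    have h4 : x ∈ T := by
      apply h
      apply Gam_of_smul a x k
      intro s hs
      apply Gam_mono hab
      exact (Submodule.Quotient.mk_eq_zero T).1 (hk s hs)
    have h5 := LinearMap.congr_fun hu ⟨x, h4⟩
    have h6 : ι x = u x := (congr_arg Subtype.val h5).symm
    rw [h1] at h6
    exact hι (h6.trans (map_zero ι).symm)
  · rintro ⟨x, y⟩ hxy
    have h1 : y ∈ Gam a (LinearMap.ker r) := Gam_map a (LinearMap.snd R _ _) hxy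
    have h2 : (y : E3) ∈ Gam a E3 := Gam_map a (LinearMap.ker r).subtype h1
    have h3 : y = 0 := by
      have h4 := hr' ⟨y, h2⟩
      have h5 : r y = 0 := y.2
      apply Subtype.ext
      exact congr_arg (fun z : Gam a E3 => (z : E3)) (h4.symm.trans h5)
    subst h3
    have h6 : x ∈ Gam b (Gam b E0) := Gam_of_inj b (Gam b E0).subtype (Submodule.injective_subtype _) x.2
    exact Gam_map b (LinearMap.inl R (Gam b E0) (LinearMap.ker r)) h6

end Alg

section Main
variable {R : Type} [CommRing R]

theorem torsion_zero {a b : Ideal R} (X : ModuleCat.{0} R)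
    (h : IsTorsionWrt b ((localCohomology a 0).obj X)) : Gam a X ≤ Gam b X := by
  obtain ⟨ev, _, hr, _⟩ := lc_zeroth a
  intro x hx
  rw [← hr] at hx
  obtain ⟨y, rfl⟩ := hx
  obtain ⟨k, hk⟩ := h y
  exact ⟨k, fun r hr => by rw [← map_smul, hk r hr, map_zero]⟩

theorem torsion_zero_conv {a b : Ideal R} (X : ModuleCat.{0} R) (h : Gam a X ≤ Gam b X) :
    IsTorsionWrt b ((localCohomology a 0).obj X) := by
  obtain ⟨ev, hi, hr, _⟩ := lc_zeroth a
  intro x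
  have hx : ev X x ∈ Gam a X := by
    rw [← hr]
    exact ⟨x, rfl⟩
  obtain ⟨k, hk⟩ := h hx
  exact ⟨k, fun r hr => hi X (by rw [map_smul, hk r hr, map_zero])⟩

theorem lc_zeroth_equiv (J : Ideal R) (X : ModuleCat.{0} R) :
    Nonempty ((localCohomology J 0).obj X ≃ₗ[R] Gam J X) := by
  obtain ⟨ev, hi, hr, _⟩ := lc_zeroth J
  exact ⟨(LinearEquiv.ofInjective (ev X) (hi X)).trans (LinearEquiv.ofEq _ _ (hr X))⟩

theorem lc_first (J : Ideal R) {X E Q : ModuleCat.{0} R} (f : X ⟶ E) (g : E ⟶ Q) (w : f ≫ g = 0)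
    (hS : (ShortComplex.mk f g w).ShortExact) [Injective E] :
    ∃ D : Gam J Q →ₗ[R] (localCohomology J 1).obj X, Function.Surjective D ∧
      ∀ x, D x = 0 ↔ ∃ y ∈ Gam J E, g y = x := by
  obtain ⟨ev, hi, hr, hn⟩ := lc_zeroth J
  obtain ⟨δ, hs, hk⟩ := lc_delta J f g w hS 0
  let e : (localCohomology J 0).obj Q ≃ₗ[R] Gam J Q :=
    (LinearEquiv.ofInjective (ev Q) (hi Q)).trans (LinearEquiv.ofEq _ _ (hr Q))
  have he : ∀ x, (e x : Q) = ev Q x := fun x => rfl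
  refine ⟨δ.hom ∘ₗ e.symm.toLinearMap, hs.comp e.symm.surjective, fun x => ?_⟩
  obtain ⟨z, rfl⟩ := e.surjective x
  have h1 : (δ.hom ∘ₗ e.symm.toLinearMap) (e z) = δ z := by simp
  rw [h1, hk, he]
  constructor
  · rintro ⟨y, rfl⟩
    refine ⟨ev E y, ?_, (hn E Q g y).symm⟩
    rw [← hr]
    exact ⟨y, rfl⟩
  · rintro ⟨y, hy, hyz⟩
    rw [← hr] at hy
    obtain ⟨y, rfl⟩ := hy
    refine ⟨y, hi Q ?_⟩
    rw [hn, hyz]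

theorem lc_shift (J : Ideal R) {X E Q : ModuleCat.{0} R} (f : X ⟶ E) (g : E ⟶ Q) (w : f ≫ g = 0)
    (hS : (ShortComplex.mk f g w).ShortExact) [Injective E] (n : ℕ) :
    Nonempty ((localCohomology J (n + 1)).obj Q ≃ₗ[R] (localCohomology J (n + 1 + 1)).obj X) := by
  obtain ⟨δ, hs, hk⟩ := lc_delta J f g w hS (n + 1)
  refine ⟨LinearEquiv.ofBijective δ.hom ⟨?_, hs⟩⟩
  rw [injective_iff_map_eq_zero]
  intro x hx
  obtain ⟨y, rfl⟩ := (hk x).1 hx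
  rw [lc_injective_zero J E n y, map_zero]

theorem torsion_of_equiv {b : Ideal R} {X Y : ModuleCat.{0} R} (e : X ≃ₗ[R] Y)
    (h : IsTorsionWrt b Y) : IsTorsionWrt b X := by
  intro x
  obtain ⟨k, hk⟩ := h (e x)
  exact ⟨k, fun r hr => e.injective (by rw [map_smul, hk r hr, map_zero])⟩

theorem main [IsNoetherianRing R] (a b : Ideal R) (hab : a ≤ b) (n : ℕ) :
    ∀ (X : ModuleCat.{0} R),
      (∀ i, i ≤ n → IsTorsionWrt b ((localCohomology a i).obj X)) →
      ∀ i, i ≤ n →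
        Nonempty ((localCohomology a i).obj X ≃ₗ[R] (localCohomology b i).obj X) := by
  induction n with
  | zero =>
    intro X h i hi
    obtain rfl : i = 0 := by omega
    have hX : Gam a X = Gam b X := le_antisymm (torsion_zero X (h 0 le_rfl)) (Gam_mono hab X)
    obtain ⟨e1⟩ := lc_zeroth_equiv a X
    obtain ⟨e2⟩ := lc_zeroth_equiv b X
    exact ⟨e1.trans ((LinearEquiv.ofEq _ _ hX).trans e2.symm)⟩
  | succ n ih =>
    intro X h i hi
    have hX : Gam a X ≤ Gam b X := torsion_zero X (h 0 (Nat.zero_le _))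
    obtain ⟨E, f, hE, hf, hGE⟩ := exists_good_embedding hab X hX
    let Q : ModuleCat.{0} R := ModuleCat.of R (E ⧸ LinearMap.range f.hom)
    let g : E ⟶ Q := ModuleCat.ofHom (Submodule.mkQ _)
    have w : f ≫ g = 0 := by
      ext x
      exact (Submodule.Quotient.mk_eq_zero _).2 ⟨x, rfl⟩
    have hS : (ShortComplex.mk f g w).ShortExact := by
      have hm : Mono f := (ModuleCat.mono_iff_injective f).2 hf
      have he : Epi g := (ModuleCat.epi_iff_surjective g).2 (Submodule.mkQ_surjective _)
      refine { exact := ?_, mono_f := hm, epi_g := he }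
      rw [ShortComplex.moduleCat_exact_iff]
      intro x hx
      exact (Submodule.Quotient.mk_eq_zero _).1 hx
    obtain ⟨Da, hDa, hka⟩ := lc_first a f g w hS
    obtain ⟨Db, hDb, hkb⟩ := lc_first b f g w hS
    have hQ : Gam a Q ≤ Gam b Q := by
      intro q hq
      obtain ⟨k, hk⟩ := h 1 (by omega) (Da ⟨q, hq⟩)
      apply Gam_of_smul b q k
      intro r hr
      have h1 : Da (r • ⟨q, hq⟩) = 0 := by rw [map_smul, hk r hr]
      obtain ⟨y, hy, hyq⟩ := (hka _).1 h1
      have h2 : g.hom y ∈ Gam b Q := Gam_map b g.hom (hGE hy)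
      have h3 : g.hom y = r • q := hyq
      rw [h3] at h2
      exact h2
    have hQ' : Gam a Q = Gam b Q := le_antisymm hQ (Gam_mono hab Q)
    have hE' : Gam a E = Gam b E := le_antisymm hGE (Gam_mono hab E)
    match i, hi with
    | 0, _ => exact ih X (fun i hi => h i (by omega)) 0 (Nat.zero_le _)
    | 1, _ =>
      let D : Gam a Q →ₗ[R] (localCohomology b 1).obj X :=
        Db ∘ₗ (LinearEquiv.ofEq _ _ hQ').toLinearMap
      have hD : Function.Surjective D := hDb.comp (LinearEquiv.ofEq _ _ hQ').surjective
      have hker : LinearMap.ker Da = LinearMap.ker D := by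
        ext x
        rw [LinearMap.mem_ker, LinearMap.mem_ker, hka, hE']
        exact (hkb (LinearEquiv.ofEq _ _ hQ' x)).symm
      exact ⟨(Da.quotKerEquivOfSurjective hDa).symm.trans
        ((Submodule.quotEquivOfEq _ _ hker).trans (D.quotKerEquivOfSurjective hD))⟩
    | j + 2, hj =>
      obtain ⟨e1⟩ := lc_shift a f g w hS j
      obtain ⟨e2⟩ := lc_shift b f g w hS j
      obtain ⟨e3⟩ := ih Q (by
        intro i hi
        match i, hi with
        | 0, _ => exact torsion_zero_conv Q hQ
        | l + 1, hl =>
          obtain ⟨e⟩ := lc_shift a f g w hS l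
          exact torsion_of_equiv e (h _ (by omega))) (j + 1) (by omega)
      exact ⟨e1.symm.trans (e3.trans e2)⟩

end Main
end LCAux

/-- Let `R` be a commutative noetherian ring, `a ⊆ b` ideals of `R`, `X` an
arbitrary `R`-module and `n ≥ 0`.  If `H^i_a(X)` is `b`-torsion for all `0 ≤ i ≤ n`, then
`H^i_a(X) ≅ H^i_b(X)` for all `0 ≤ i ≤ n`. -/
theorem statement10 {R : Type} [CommRing R] [IsNoetherianRing R] (a b : Ideal R) (hab : a ≤ b)
    (X : ModuleCat R) (n : ℕ)
    (h : ∀ i, i ≤ n → IsTorsionWrt b ((localCohomology a i).obj X)) :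
    ∀ i, i ≤ n →
      Nonempty ((localCohomology a i).obj X ≅ (localCohomology b i).obj X) := by
  intro i hi
  obtain ⟨e⟩ := LCAux.main a b hab n X h i hi
  exact ⟨e.toModuleIso⟩
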